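/- arXiv:2309.15665 — 2 statements merged into one kernel-verified Lean document; each statement's English description precedes it below -/
import Mathlib

section
/- Assume R_s = αβ − (1−α)γ + δ > 0 and set ρ = min(μ, δ). The set 𝒟 = {(X, Y, D, V) ∈ ℝ⁴₊ : 0 ≤ X + Y ≤ λ/ρ, 0 ≤ D ≤ aλ/(ρ(αβ + δ − γ(1−α))), 0 ≤ V ≤ aλαβ/(ρc(αβ + δ − γ(1−α)))} is positively invariant for the HBV system: any solution starting in 𝒟 at t = 0 remains in 𝒟 for all t ≥ 0. -/
/-- Integrating-factor comparison lemma. -/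
theorem hbv_aux_nonneg (f f' p : ℝ → ℝ) (hp : Continuous p) (T : ℝ) (hT : 0 ≤ T)
    (hf : ∀ t, HasDerivAt f (f' t) t)
    (hge : ∀ t, 0 ≤ t → t ≤ T → 0 ≤ f' t + p t * f t) (h0 : 0 ≤ f 0) : 0 ≤ f T := by
  have hP : ∀ t, HasDerivAt (fun t => ∫ s in (0:ℝ)..t, p s) (p t) t := fun t =>
    intervalIntegral.integral_hasDerivAt_right (hp.intervalIntegrable _ _)
      hp.aestronglyMeasurable.stronglyMeasurableAtFilter hp.continuousAt
  set P : ℝ → ℝ := fun t => ∫ s in (0:ℝ)..t, p s with hPd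
  have hg : ∀ t, HasDerivAt (fun t => f t * Real.exp (P t))
      (f' t * Real.exp (P t) + f t * (Real.exp (P t) * p t)) t :=
    fun t => (hf t).mul (hP t).exp
  have hm : MonotoneOn (fun t => f t * Real.exp (P t)) (Set.Icc 0 T) := by
    apply monotoneOn_of_deriv_nonneg (convex_Icc 0 T)
    · exact fun t _ => (hg t).continuousAt.continuousWithinAt
    · exact fun t _ => (hg t).differentiableAt.differentiableWithinAt
    · intro t ht
      rw [interior_Icc] at ht
      rw [(hg t).deriv]
      have := mul_nonneg (hge t ht.1.le ht.2.le) (Real.exp_pos (P t)).le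
      linarith
  have h1 := hm (Set.left_mem_Icc.2 hT) (Set.right_mem_Icc.2 hT) hT
  have h2 : 0 ≤ f T * Real.exp (P T) :=
    le_trans (mul_nonneg h0 (Real.exp_pos _).le) h1
  exact nonneg_of_mul_nonneg_left h2 (Real.exp_pos _)

/-- The squared negative part is differentiable. -/
theorem hbv_aux_sq (x : ℝ) : HasDerivAt (fun x : ℝ => (min x 0) ^ 2) (2 * min x 0) x := by
  rcases lt_trichotomy x 0 with h | h | h
  · have : HasDerivAt (fun x : ℝ => x ^ 2) (2 * min x 0) x := by
      rw [min_eq_left h.le]; simpa using hasDerivAt_pow 2 x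
    refine this.congr_of_eventuallyEq ?_
    filter_upwards [gt_mem_nhds h] with y hy
    rw [min_eq_left hy.le]
  · subst h
    rw [hasDerivAt_iff_isLittleO]
    simp only [min_self, mul_zero, smul_zero, sub_zero]
    have h2 : (fun x : ℝ => x ^ 2) =o[nhds 0] (fun x : ℝ => x) := by
      simpa using Asymptotics.isLittleO_pow_id (𝕜 := ℝ) (n := 2) (by norm_num)
    refine Asymptotics.IsBigO.trans_isLittleO ?_ h2
    refine Asymptotics.IsBigO.of_bound 1 (Filter.Eventually.of_forall fun y => ?_)
    rcases le_total y 0 with hy | hy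
    · simp [min_eq_left hy]
    · simp [min_eq_right hy]; positivity
  · have : HasDerivAt (fun _ : ℝ => (0:ℝ)) (2 * min x 0) x := by
      rw [min_eq_right h.le]; simpa using hasDerivAt_const x (0:ℝ)
    refine this.congr_of_eventuallyEq ?_
    filter_upwards [lt_mem_nhds h] with y hy
    rw [min_eq_right hy.le]; simp

/-- One cross term of the energy estimate. -/
theorem hbv_aux_term (m M u v d : ℝ) (hm : 0 ≤ m) (hM : m ≤ M) (hd : 0 ≤ d) :
    2 * min u 0 * (m * v - d * u) ≤ M * ((min u 0) ^ 2 + (min v 0) ^ 2) := by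
  have hu : min u 0 ≤ 0 := min_le_right _ _
  have hv : min v 0 ≤ v := min_le_left _ _
  have huu : min u 0 * u = (min u 0) ^ 2 := by
    rcases le_total u 0 with h | h
    · rw [min_eq_left h]; ring
    · rw [min_eq_right h]; ring
  have e1 : min u 0 * v ≤ min u 0 * min v 0 := mul_le_mul_of_nonpos_left hv hu
  have e2 : 2 * (min u 0 * min v 0) ≤ (min u 0) ^ 2 + (min v 0) ^ 2 := by
    nlinarith [sq_nonneg (min u 0 - min v 0)]
  have e3 : m * (2 * (min u 0 * v)) ≤ m * ((min u 0) ^ 2 + (min v 0) ^ 2) :=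
    mul_le_mul_of_nonneg_left (by linarith) hm
  have e4 : m * ((min u 0) ^ 2 + (min v 0) ^ 2) ≤ M * ((min u 0) ^ 2 + (min v 0) ^ 2) :=
    mul_le_mul_of_nonneg_right hM (by positivity)
  have e5 : 0 ≤ d * (min u 0) ^ 2 := by positivity
  have e6 : 2 * min u 0 * (m * v - d * u)
      = m * (2 * (min u 0 * v)) - 2 * (d * (min u 0) ^ 2) := by
    rw [← huu]; ring
  linarith


/-- Positive invariance of the region
𝒟 = {(X,Y,D,V) ∈ ℝ⁴₊ : X+Y ≤ λ/ρ, D ≤ aλ/(ρ(αβ+δ−γ(1−α))),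
V ≤ aλαβ/(ρc(αβ+δ−γ(1−α)))} for the HBV system, where ρ = min(μ,δ) and
R_s = αβ − (1−α)γ + δ > 0. -/
theorem hbv_positively_invariant_region
    (lam μ k δ a β γ c α ρ : ℝ)
    (hlam : 0 < lam) (hμ : 0 < μ) (hk : 0 < k) (hδ : 0 < δ)
    (ha : 0 < a) (hβ : 0 < β) (hγ : 0 < γ) (hc : 0 < c)
    (hα : α ∈ Set.Ioo (0 : ℝ) 1)
    (hρ : ρ = min μ δ)
    (hRs : 0 < α * β - (1 - α) * γ + δ)
    (X Y D V : ℝ → ℝ)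
    (hX : ∀ t, HasDerivAt X (lam - μ * X t - k * V t * X t) t)
    (hY : ∀ t, HasDerivAt Y (k * V t * X t - δ * Y t) t)
    (hD : ∀ t, HasDerivAt D (a * Y t + γ * (1 - α) * D t - α * β * D t - δ * D t) t)
    (hV : ∀ t, HasDerivAt V (α * β * D t - c * V t) t)
    (h0 : 0 ≤ X 0 ∧ 0 ≤ Y 0 ∧ 0 ≤ D 0 ∧ 0 ≤ V 0 ∧
          X 0 + Y 0 ≤ lam / ρ ∧
          D 0 ≤ a * lam / (ρ * (α * β + δ - γ * (1 - α))) ∧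
          V 0 ≤ a * lam * α * β / (ρ * c * (α * β + δ - γ * (1 - α)))) :
    ∀ t ≥ (0 : ℝ),
      0 ≤ X t ∧ 0 ≤ Y t ∧ 0 ≤ D t ∧ 0 ≤ V t ∧
      X t + Y t ≤ lam / ρ ∧
      D t ≤ a * lam / (ρ * (α * β + δ - γ * (1 - α))) ∧
      V t ≤ a * lam * α * β / (ρ * c * (α * β + δ - γ * (1 - α))) := by

  obtain ⟨hα0, hα1⟩ := hα
  obtain ⟨x0, y0, d0, v0, n0, D0, V0⟩ := h0
  have hab : 0 < α * β := mul_pos hα0 hβ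
  have hρ0 : 0 < ρ := by rw [hρ]; exact lt_min hμ hδ
  have hρμ : ρ ≤ μ := by rw [hρ]; exact min_le_left _ _
  have hρδ : ρ ≤ δ := by rw [hρ]; exact min_le_right _ _
  obtain ⟨R, hR⟩ : ∃ R, R = α * β + δ - γ * (1 - α) := ⟨_, rfl⟩
  have hR0 : 0 < R := by rw [hR]; linarith
  rw [← hR] at D0 V0 ⊢
  have hXc : Continuous X := continuous_iff_continuousAt.2 fun t => (hX t).continuousAt
  have hVc : Continuous V := continuous_iff_continuousAt.2 fun t => (hV t).continuousAt
  have Xn : ∀ t, 0 ≤ t → 0 ≤ X t := by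
    intro T hT
    refine hbv_aux_nonneg X _ (fun t => μ + k * V t) (by fun_prop) T hT hX ?_ x0
    intro t _ _
    have : lam - μ * X t - k * V t * X t + (μ + k * V t) * X t = lam := by ring
    simp only [this]; exact hlam.le
  have key : ∀ t, 0 ≤ t → 0 ≤ Y t ∧ 0 ≤ D t ∧ 0 ≤ V t := by
    intro T hT
    obtain ⟨M, hM⟩ := (isCompact_Icc (a := (0:ℝ)) (b := T)).bddAbove_image hXc.continuousOn
    have hM' : ∀ t, 0 ≤ t → t ≤ T → X t ≤ M := fun t h1 h2 =>
      hM (Set.mem_image_of_mem X ⟨h1, h2⟩)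
    have hM0 : 0 ≤ M := (Xn 0 le_rfl).trans (hM' 0 le_rfl hT)
    have hkM : 0 ≤ k * M := by positivity
    have hW := hbv_aux_nonneg
      (fun t => -((min (Y t) 0) ^ 2 + (min (D t) 0) ^ 2 + (min (V t) 0) ^ 2))
      _ (fun _ => -(k * M + a + α * β)) continuous_const T hT
      (fun t => ((((hbv_aux_sq (Y t)).comp t (hY t)).add
        ((hbv_aux_sq (D t)).comp t (hD t))).add ((hbv_aux_sq (V t)).comp t (hV t))).neg)
      (by
        intro t h1 h2
        have t1 := hbv_aux_term (k * X t) (k * M) (Y t) (V t) δ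
          (mul_nonneg hk.le (Xn t h1)) (mul_le_mul_of_nonneg_left (hM' t h1 h2) hk.le) hδ.le
        have t2 := hbv_aux_term a a (D t) (Y t) R ha.le le_rfl hR0.le
        have t3 := hbv_aux_term (α * β) (α * β) (V t) (D t) c hab.le le_rfl hc.le
        have q1 : k * V t * X t - δ * Y t = k * X t * V t - δ * Y t := by ring
        have q2 : a * Y t + γ * (1 - α) * D t - α * β * D t - δ * D t
          = a * Y t - R * D t := by rw [hR]; ring
        rw [q1, q2]
        have p1 := mul_nonneg hkM (sq_nonneg (min (D t) 0))
        have p2 := mul_nonneg ha.le (sq_nonneg (min (V t) 0))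
        have p3 := mul_nonneg hab.le (sq_nonneg (min (Y t) 0))
        nlinarith)
      (by simp [min_eq_right y0, min_eq_right d0, min_eq_right v0])
    have z : ∀ u : ℝ, (min u 0) ^ 2 ≤ 0 → 0 ≤ u := by
      intro u hu
      have : min u 0 = 0 := pow_eq_zero_iff (two_ne_zero) |>.1 (le_antisymm hu (sq_nonneg _))
      exact min_eq_right_iff.1 this
    have s1 := sq_nonneg (min (Y T) 0)
    have s2 := sq_nonneg (min (D T) 0)
    have s3 := sq_nonneg (min (V T) 0)
    exact ⟨z _ (by linarith), z _ (by linarith), z _ (by linarith)⟩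
  have Nn : ∀ t, 0 ≤ t → X t + Y t ≤ lam / ρ := by
    intro T hT
    have := hbv_aux_nonneg (fun t => lam / ρ - (X t + Y t)) _ (fun _ => ρ) continuous_const T hT
      (fun t => ((hX t).add (hY t)).const_sub (lam / ρ)) (by
        intro t h1 _
        have e : ρ * (lam / ρ) = lam := by field_simp
        have a1 := mul_le_mul_of_nonneg_right hρμ (Xn t h1)
        have a2 := mul_le_mul_of_nonneg_right hρδ (key t h1).1
        simp only [mul_sub, e]
        linarith) (by simpa using n0)
    simpa using this
  have Dn : ∀ t, 0 ≤ t → D t ≤ a * lam / (ρ * R) := by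
    intro T hT
    have := hbv_aux_nonneg (fun t => a * lam / (ρ * R) - D t) _ (fun _ => R) continuous_const T hT
      (fun t => (hD t).const_sub (a * lam / (ρ * R))) (by
        intro t h1 _
        have e : R * (a * lam / (ρ * R)) = a * (lam / ρ) := by field_simp
        have a1 := mul_le_mul_of_nonneg_left (Nn t h1) ha.le
        have a2 := mul_nonneg ha.le (Xn t h1)
        simp only [mul_sub, e]
        have : R * D t = α * β * D t + δ * D t - γ * (1 - α) * D t := by rw [hR]; ring
        linarith) (by simpa using D0)
    simpa using this
  have Vn : ∀ t, 0 ≤ t → V t ≤ a * lam * α * β / (ρ * c * R) := by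
    intro T hT
    have := hbv_aux_nonneg (fun t => a * lam * α * β / (ρ * c * R) - V t) _ (fun _ => c)
      continuous_const T hT
      (fun t => (hV t).const_sub (a * lam * α * β / (ρ * c * R))) (by
        intro t h1 _
        have e : c * (a * lam * α * β / (ρ * c * R)) = α * β * (a * lam / (ρ * R)) := by
          field_simp
        have a1 := mul_le_mul_of_nonneg_left (Dn t h1) hab.le
        simp only [mul_sub, e]
        linarith) (by simpa using V0)
    simpa using this
  intro t ht
  exact ⟨Xn t ht, (key t ht).1, (key t ht).2.1, (key t ht).2.2, Nn t ht, Dn t ht, Vn t ht⟩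
end

section
/- Assume R_s = αβ − (1−α)γ + δ > 0 and R_0 = akλαβ/(cδμR_s) > 1. Then the endemic equilibrium E_i = (X₁, Y₁, D₁, V₁) is globally asymptotically stable: every solution of the HBV system with X(0), Y(0), D(0), V(0) > 0 satisfies (X(t), Y(t), D(t), V(t)) → (X₁, Y₁, D₁, V₁) as t → ∞. -/
open Filter

/-- Boundedness on the nonnegative half-line. -/
def HBdd (f : ℝ → ℝ) : Prop := ∃ M : ℝ, ∀ t, 0 ≤ t → |f t| ≤ M

lemma HBdd.const (r : ℝ) : HBdd (fun _ => r) := ⟨|r|, fun _ _ => le_rfl⟩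

lemma HBdd.add {f g : ℝ → ℝ} (hf : HBdd f) (hg : HBdd g) : HBdd (fun t => f t + g t) := by
  obtain ⟨M, hM⟩ := hf
  obtain ⟨N, hN⟩ := hg
  exact ⟨M + N, fun t ht => (abs_add_le _ _).trans (add_le_add (hM t ht) (hN t ht))⟩

lemma HBdd.sub {f g : ℝ → ℝ} (hf : HBdd f) (hg : HBdd g) : HBdd (fun t => f t - g t) := by
  obtain ⟨M, hM⟩ := hf
  obtain ⟨N, hN⟩ := hg
  exact ⟨M + N, fun t ht => (abs_sub _ _).trans (add_le_add (hM t ht) (hN t ht))⟩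

lemma HBdd.mul {f g : ℝ → ℝ} (hf : HBdd f) (hg : HBdd g) : HBdd (fun t => f t * g t) := by
  obtain ⟨M, hM⟩ := hf
  obtain ⟨N, hN⟩ := hg
  refine ⟨M * N, fun t ht => ?_⟩
  rw [abs_mul]
  exact mul_le_mul (hM t ht) (hN t ht) (abs_nonneg _) ((abs_nonneg _).trans (hM t ht))

/-- Barbalat's lemma in the form with a bounded second derivative. -/
lemma hbv_barbalat (f g h : ℝ → ℝ) (l : ℝ) (hf : ∀ t, HasDerivAt f (g t) t)
    (hg : ∀ t, HasDerivAt g (h t) t) (hb : HBdd h) (hl : Tendsto f atTop (nhds l)) :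
    Tendsto g atTop (nhds 0) := by
  obtain ⟨M0, hM0⟩ := hb
  obtain ⟨M, hMpos, hM⟩ : ∃ M : ℝ, 0 < M ∧ ∀ t, 0 ≤ t → |h t| ≤ M :=
    ⟨max M0 1, by positivity, fun t ht => (hM0 t ht).trans (le_max_left _ _)⟩
  have lip : ∀ t s, 0 ≤ t → t ≤ s → |g s - g t| ≤ M * (s - t) := by
    intro t s ht hts
    have := norm_image_sub_le_of_norm_deriv_le_segment' (f := g) (f' := h) (a := t) (b := s)
      (C := M) (fun x _ => (hg x).hasDerivWithinAt) (fun x hx => hM x (ht.trans hx.1)) s ⟨hts, le_rfl⟩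
    simpa using this
  have tay : ∀ t τ, 0 ≤ t → 0 ≤ τ → |f (t + τ) - f t - g t * τ| ≤ M * τ * τ := by
    intro t τ ht hτ
    have := norm_image_sub_le_of_norm_deriv_le_segment' (f := fun s => f s - g t * s)
      (f' := fun s => g s - g t) (a := t) (b := t + τ) (C := M * τ)
      (fun x _ => by
        have h1 : HasDerivAt (fun s : ℝ => g t * s) (g t) x := by
          simpa using (hasDerivAt_id x).const_mul (g t)
        exact ((hf x).sub h1).hasDerivWithinAt)
      (fun x hx => (lip t x ht hx.1).trans
        (mul_le_mul_of_nonneg_left (by linarith [hx.2]) hMpos.le)) (t + τ) ⟨by linarith, le_rfl⟩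
    simp only [Real.norm_eq_abs] at this
    have e : f (t + τ) - g t * (t + τ) - (f t - g t * t) = f (t + τ) - f t - g t * τ := by ring
    rw [e] at this
    simpa using this
  rw [Metric.tendsto_atTop] at hl ⊢
  intro ε hε
  set τ := ε / (2 * M) with hτ
  have hτp : 0 < τ := by positivity
  have hMτ : M * τ = ε / 2 := by rw [hτ]; field_simp
  obtain ⟨N, hN⟩ := hl (ε * τ / 4) (by positivity)
  refine ⟨max N 0, fun t ht => ?_⟩
  have ht0 : 0 ≤ t := (le_max_right _ _).trans ht
  have htN : N ≤ t := (le_max_left _ _).trans ht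
  have h1 := hN t htN
  have h2 := hN (t + τ) (by linarith)
  have h3 := tay t τ ht0 hτp.le
  rw [Real.dist_eq, abs_lt] at h1 h2
  rw [hMτ, abs_le] at h3
  rw [Real.dist_eq, sub_zero, abs_lt]
  constructor
  · by_contra hcon
    push Not at hcon
    have := mul_le_mul_of_nonneg_right hcon hτp.le
    nlinarith [h1.1, h1.2, h2.1, h2.2, h3.1, h3.2]
  · by_contra hcon
    push Not at hcon
    have := mul_le_mul_of_nonneg_right hcon hτp.le
    nlinarith [h1.1, h1.2, h2.1, h2.2, h3.1, h3.2]

/-- Continuation principle for positivity. -/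
lemma hbv_cont (m : ℝ → ℝ) (hm : Continuous m) (h0 : 0 < m 0)
    (step : ∀ T, 0 < T → (∀ t, 0 ≤ t → t < T → 0 < m t) → 0 < m T) :
    ∀ t, 0 ≤ t → 0 < m t := by
  by_contra hcon
  push Not at hcon
  obtain ⟨t, ht, hmt⟩ := hcon
  let S : Set ℝ := {t | 0 ≤ t ∧ m t ≤ 0}
  have hS : IsClosed S := (isClosed_le continuous_const continuous_id).inter
    (isClosed_le hm continuous_const)
  have hne : S.Nonempty := ⟨t, ht, hmt⟩
  have hbb : BddBelow S := ⟨0, fun x hx => hx.1⟩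
  have hmem := hS.csInf_mem hne hbb
  have hpos : 0 < sInf S := by
    rcases hmem.1.lt_or_eq with h | h
    · exact h
    · have := hmem.2
      rw [← h] at this
      linarith
  have := step (sInf S) hpos (fun t ht0 htT => by
    by_contra hc
    push Not at hc
    exact absurd (csInf_le hbb (show t ∈ S from ⟨ht0, hc⟩)) (by linarith))
  linarith [hmem.2]

lemma hbv_pos_step (f f' : ℝ → ℝ) (M T : ℝ) (hT : 0 < T) (hf : ∀ t, HasDerivAt f (f' t) t)
    (h0 : 0 < f 0) (hge : ∀ t, 0 ≤ t → t < T → -M * f t ≤ f' t) : 0 < f T := by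
  have hd : ∀ t, HasDerivAt (fun t => f t * Real.exp (M * t))
      (f' t * Real.exp (M * t) + f t * (Real.exp (M * t) * M)) t := by
    intro t
    have h1 : HasDerivAt (fun t : ℝ => M * t) M t := by
      simpa using (hasDerivAt_id t).const_mul M
    exact (hf t).mul h1.exp
  have mono : MonotoneOn (fun t => f t * Real.exp (M * t)) (Set.Icc 0 T) := by
    apply monotoneOn_of_deriv_nonneg (convex_Icc 0 T)
    · exact fun t _ => (hd t).continuousAt.continuousWithinAt
    · exact fun t _ => (hd t).differentiableAt.differentiableWithinAt
    · intro t ht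
      rw [interior_Icc] at ht
      rw [(hd t).deriv]
      have := hge t ht.1.le ht.2
      have e := Real.exp_pos (M * t)
      nlinarith
  have := mono (Set.left_mem_Icc.2 hT.le) (Set.right_mem_Icc.2 hT.le) hT.le
  simp only [mul_zero, Real.exp_zero, mul_one] at this
  exact pos_of_mul_pos_left (lt_of_lt_of_le h0 this) (Real.exp_pos _).le

lemma hbv_pos (m p q r s : ℝ) (hm : 0 < m) (hp : 0 < p) (hq : 0 < q) (hr : 0 < r) (hs : 0 < s)
    (x y d v : ℝ → ℝ)
    (hx : ∀ t, HasDerivAt x (m * (1 - x t) + p * (1 - v t * x t)) t)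
    (hy : ∀ t, HasDerivAt y (q * (v t * x t - y t)) t)
    (hd : ∀ t, HasDerivAt d (r * (y t - d t)) t)
    (hv : ∀ t, HasDerivAt v (s * (d t - v t)) t)
    (hx0 : 0 < x 0) (hy0 : 0 < y 0) (hd0 : 0 < d 0) (hv0 : 0 < v 0) :
    ∀ t, 0 ≤ t → 0 < x t ∧ 0 < y t ∧ 0 < d t ∧ 0 < v t := by
  have cx : Continuous x := continuous_iff_continuousAt.2 fun t => (hx t).continuousAt
  have cy : Continuous y := continuous_iff_continuousAt.2 fun t => (hy t).continuousAt
  have cd : Continuous d := continuous_iff_continuousAt.2 fun t => (hd t).continuousAt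
  have cv : Continuous v := continuous_iff_continuousAt.2 fun t => (hv t).continuousAt
  have key := hbv_cont (fun t => min (x t) (min (y t) (min (d t) (v t)))) (by fun_prop)
    (by simp only [lt_min_iff]; exact ⟨hx0, hy0, hd0, hv0⟩) ?_
  · intro t ht
    simpa only [lt_min_iff] using key t ht
  · intro T hT hall
    simp only [lt_min_iff] at hall ⊢
    obtain ⟨B, hB⟩ := (isCompact_Icc (a := (0 : ℝ)) (b := T)).bddAbove_image cv.continuousOn
    refine ⟨hbv_pos_step x _ (m + p * B) T hT hx hx0 ?_, hbv_pos_step y _ q T hT hy hy0 ?_,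
      hbv_pos_step d _ r T hT hd hd0 ?_, hbv_pos_step v _ s T hT hv hv0 ?_⟩
    · intro t h0 h1
      have hvB : v t ≤ B := hB ⟨t, ⟨h0, h1.le⟩, rfl⟩
      have := mul_nonneg hp.le (mul_nonneg (sub_nonneg.2 hvB) (hall t h0 h1).1.le)
      nlinarith
    · intro t h0 h1
      obtain ⟨a1, a2, a3, a4⟩ := hall t h0 h1
      have := mul_pos hq (mul_pos a4 a1)
      nlinarith
    · intro t h0 h1
      obtain ⟨a1, a2, a3, a4⟩ := hall t h0 h1
      have := mul_pos hr a2
      nlinarith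
    · intro t h0 h1
      obtain ⟨a1, a2, a3, a4⟩ := hall t h0 h1
      have := mul_pos hs a3
      nlinarith

lemma hbv_phi_nonneg (u : ℝ) (hu : 0 < u) : 0 ≤ u - 1 - Real.log u := by
  linarith [Real.log_le_sub_one_of_pos hu]

lemma hbv_phi_bound (u C : ℝ) (hu : 0 < u) (h : u - 1 - Real.log u ≤ C) :
    u ≤ 2 * (C + Real.log 2) := by
  have := Real.log_le_sub_one_of_pos (half_pos hu)
  rw [Real.log_div hu.ne' two_ne_zero] at this
  linarith

lemma hbv_amgm (x y d v : ℝ) (hx : 0 < x) (hy : 0 < y) (hd : 0 < d) (hv : 0 < v) :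
    4 ≤ 1 / x + v * x / y + y / d + d / v := by
  have h1 := Real.log_le_sub_one_of_pos (show 0 < 1 / x by positivity)
  have h2 := Real.log_le_sub_one_of_pos (show 0 < v * x / y by positivity)
  have h3 := Real.log_le_sub_one_of_pos (show 0 < y / d by positivity)
  have h4 := Real.log_le_sub_one_of_pos (show 0 < d / v by positivity)
  rw [Real.log_div (by positivity) (by positivity)] at h1 h2 h3 h4
  rw [Real.log_mul hv.ne' hx.ne'] at h2
  rw [Real.log_one] at h1
  linarith

lemma hbv_phi_deriv (f : ℝ → ℝ) (f' t : ℝ) (hf : HasDerivAt f f' t) (h : 0 < f t) :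
    HasDerivAt (fun t => f t - 1 - Real.log (f t)) (f' - f' / f t) t :=
  (hf.sub_const 1).sub (hf.log h.ne')

/-- Convergence for the normalised system. -/
lemma hbv_core (m p q r s : ℝ) (hm : 0 < m) (hp : 0 < p) (hq : 0 < q) (hr : 0 < r) (hs : 0 < s)
    (x y d v : ℝ → ℝ)
    (hx : ∀ t, HasDerivAt x (m * (1 - x t) + p * (1 - v t * x t)) t)
    (hy : ∀ t, HasDerivAt y (q * (v t * x t - y t)) t)
    (hd : ∀ t, HasDerivAt d (r * (y t - d t)) t)
    (hv : ∀ t, HasDerivAt v (s * (d t - v t)) t)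
    (hx0 : 0 < x 0) (hy0 : 0 < y 0) (hd0 : 0 < d 0) (hv0 : 0 < v 0) :
    Tendsto x atTop (nhds 1) ∧ Tendsto y atTop (nhds 1) ∧ Tendsto d atTop (nhds 1) ∧
      Tendsto v atTop (nhds 1) := by
  have pos := hbv_pos m p q r s hm hp hq hr hs x y d v hx hy hd hv hx0 hy0 hd0 hv0
  have cx : Continuous x := continuous_iff_continuousAt.2 fun t => (hx t).continuousAt
  let L : ℝ → ℝ := fun t => (x t - 1 - Real.log (x t)) / p + (y t - 1 - Real.log (y t)) / q
    + (d t - 1 - Real.log (d t)) / r + (v t - 1 - Real.log (v t)) / s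
  have hL : ∀ t, 0 ≤ t → ∃ L', HasDerivAt L L' t ∧ L' ≤ -(m / p * ((1 - x t) ^ 2 / x t)) := by
    intro t ht
    obtain ⟨p1, p2, p3, p4⟩ := pos t ht
    refine ⟨_, ((((hbv_phi_deriv x _ t (hx t) p1).div_const p).add
      ((hbv_phi_deriv y _ t (hy t) p2).div_const q)).add
      ((hbv_phi_deriv d _ t (hd t) p3).div_const r)).add
      ((hbv_phi_deriv v _ t (hv t) p4).div_const s), ?_⟩
    have am := hbv_amgm _ _ _ _ p1 p2 p3 p4
    have e : ∀ X Y D V : ℝ, 0 < X → 0 < Y → 0 < D → 0 < V →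
        (m * (1 - X) + p * (1 - V * X) - (m * (1 - X) + p * (1 - V * X)) / X) / p
        + (q * (V * X - Y) - q * (V * X - Y) / Y) / q
        + (r * (Y - D) - r * (Y - D) / D) / r + (s * (D - V) - s * (D - V) / V) / s
        = -(m / p * ((1 - X) ^ 2 / X)) + (4 - (1 / X + V * X / Y + Y / D + D / V)) := by
      intro X Y D V h1 h2 h3 h4
      field_simp
      ring
    rw [e _ _ _ _ p1 p2 p3 p4]
    linarith
  -- `L` is antitone
  have anti : ∀ t, 0 ≤ t → L t ≤ L 0 := by
    have : AntitoneOn L (Set.Ici 0) := by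
      apply antitoneOn_of_deriv_nonpos (convex_Ici 0)
      · intro t ht
        obtain ⟨L', h1, -⟩ := hL t ht
        exact h1.continuousAt.continuousWithinAt
      · intro t ht
        obtain ⟨L', h1, -⟩ := hL t (interior_subset ht)
        exact h1.differentiableAt.differentiableWithinAt
      · intro t ht
        have ht' : (0 : ℝ) ≤ t := interior_subset ht
        obtain ⟨L', h1, h2⟩ := hL t ht'
        rw [h1.deriv]
        have := (pos t ht').1
        have : 0 ≤ m / p * ((1 - x t) ^ 2 / x t) := by positivity
        linarith
    exact fun t ht => this (Set.mem_Ici.2 le_rfl) ht ht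
  have comp : ∀ t, 0 ≤ t → 0 ≤ (x t - 1 - Real.log (x t)) / p ∧
      0 ≤ (y t - 1 - Real.log (y t)) / q ∧ 0 ≤ (d t - 1 - Real.log (d t)) / r ∧
      0 ≤ (v t - 1 - Real.log (v t)) / s := by
    intro t ht
    obtain ⟨p1, p2, p3, p4⟩ := pos t ht
    exact ⟨div_nonneg (hbv_phi_nonneg _ p1) hp.le, div_nonneg (hbv_phi_nonneg _ p2) hq.le,
      div_nonneg (hbv_phi_nonneg _ p3) hr.le, div_nonneg (hbv_phi_nonneg _ p4) hs.le⟩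
  have Lnn : ∀ t, 0 ≤ t → 0 ≤ L t := by
    intro t ht
    obtain ⟨p1, p2, p3, p4⟩ := comp t ht
    exact add_nonneg (add_nonneg (add_nonneg p1 p2) p3) p4
  have hxB : ∀ t, 0 ≤ t → x t ≤ 2 * (L 0 * p + Real.log 2) := by
    intro t ht
    obtain ⟨p1, p2, p3, p4⟩ := comp t ht
    refine hbv_phi_bound _ _ (pos t ht).1 ((div_le_iff₀ hp).1 ?_)
    refine le_trans ?_ (anti t ht)
    simp only [L]; linarith
  have bx : HBdd x := ⟨2 * (L 0 * p + Real.log 2), fun t ht => by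
    rw [abs_of_pos (pos t ht).1]; exact hxB t ht⟩
  have bY : HBdd y := ⟨2 * (L 0 * q + Real.log 2), fun t ht => by
    rw [abs_of_pos (pos t ht).2.1]
    obtain ⟨p1, p2, p3, p4⟩ := comp t ht
    refine hbv_phi_bound _ _ (pos t ht).2.1 ((div_le_iff₀ hq).1 ?_)
    refine le_trans ?_ (anti t ht)
    simp only [L]; linarith⟩
  have bd : HBdd d := ⟨2 * (L 0 * r + Real.log 2), fun t ht => by
    rw [abs_of_pos (pos t ht).2.2.1]
    obtain ⟨p1, p2, p3, p4⟩ := comp t ht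
    refine hbv_phi_bound _ _ (pos t ht).2.2.1 ((div_le_iff₀ hr).1 ?_)
    refine le_trans ?_ (anti t ht)
    simp only [L]; linarith⟩
  have bv : HBdd v := ⟨2 * (L 0 * s + Real.log 2), fun t ht => by
    rw [abs_of_pos (pos t ht).2.2.2]
    obtain ⟨p1, p2, p3, p4⟩ := comp t ht
    refine hbv_phi_bound _ _ (pos t ht).2.2.2 ((div_le_iff₀ hs).1 ?_)
    refine le_trans ?_ (anti t ht)
    simp only [L]; linarith⟩
  have bx' : HBdd (fun t => m * (1 - x t) + p * (1 - v t * x t)) :=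
    ((HBdd.const m).mul ((HBdd.const 1).sub bx)).add
      ((HBdd.const p).mul ((HBdd.const 1).sub (bv.mul bx)))
  have by' : HBdd (fun t => q * (v t * x t - y t)) := (HBdd.const q).mul ((bv.mul bx).sub bY)
  have bd' : HBdd (fun t => r * (y t - d t)) := (HBdd.const r).mul (bY.sub bd)
  have bv' : HBdd (fun t => s * (d t - v t)) := (HBdd.const s).mul (bd.sub bv)
  -- `x → 1`
  have tx : Tendsto x atTop (nhds 1) := by
    set B := 2 * (L 0 * p + Real.log 2) with hB
    have hBpos : 0 < B := lt_of_lt_of_le hx0 (hxB 0 le_rfl)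
    let κ := m / p / B
    have hκ : 0 < κ := by positivity
    let G : ℝ → ℝ := fun t => ∫ u in (0 : ℝ)..t, (1 - x u) * (1 - x u)
    have hcont : Continuous (fun u => (1 - x u) * (1 - x u)) := by fun_prop
    have hG : ∀ t, HasDerivAt G ((1 - x t) * (1 - x t)) t := fun t =>
      intervalIntegral.integral_hasDerivAt_right (hcont.intervalIntegrable _ _)
        (hcont.stronglyMeasurableAtFilter _ _) hcont.continuousAt
    have G0 : G 0 = 0 := intervalIntegral.integral_same
    have Gmono : Monotone G := by
      apply monotone_of_deriv_nonneg
      · exact fun t => (hG t).differentiableAt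
      · intro t
        rw [(hG t).deriv]
        exact mul_self_nonneg _
    have anti2 : AntitoneOn (fun t => L t + κ * G t) (Set.Ici 0) := by
      apply antitoneOn_of_deriv_nonpos (convex_Ici 0)
      · intro t ht
        obtain ⟨L', h1, -⟩ := hL t ht
        exact (h1.add ((hG t).const_mul κ)).continuousAt.continuousWithinAt
      · intro t ht
        obtain ⟨L', h1, -⟩ := hL t (interior_subset ht)
        exact (h1.add ((hG t).const_mul κ)).differentiableAt.differentiableWithinAt
      · intro t ht
        have ht' : (0 : ℝ) ≤ t := interior_subset ht
        obtain ⟨L', h1, h2⟩ := hL t ht'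
        have h3 : deriv (fun t => L t + κ * G t) t = L' + κ * ((1 - x t) * (1 - x t)) :=
          (h1.add ((hG t).const_mul κ)).deriv
        rw [h3]
        have hxp := (pos t ht').1
        have h4 : (1 - x t) ^ 2 / B ≤ (1 - x t) ^ 2 / x t :=
          div_le_div_of_nonneg_left (sq_nonneg _) hxp (hxB t ht')
        have h5 := mul_le_mul_of_nonneg_left h4 (show 0 ≤ m / p by positivity)
        have h6 : κ * ((1 - x t) * (1 - x t)) = m / p * ((1 - x t) ^ 2 / B) := by
          simp only [κ]; ring
        linarith
    have Gbdd : ∀ t, G t ≤ L 0 / κ := by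
      have h1 : ∀ t, 0 ≤ t → G t ≤ L 0 / κ := by
        intro t ht
        have h2 := anti2 (Set.mem_Ici.2 le_rfl) (Set.mem_Ici.2 ht) ht
        simp only [G0, mul_zero, add_zero] at h2
        rw [le_div_iff₀ hκ]
        linarith [Lnn t ht]
      intro t
      exact (Gmono (le_max_left t 0)).trans (h1 _ (le_max_right t 0))
    have Gt := tendsto_atTop_ciSup Gmono ⟨L 0 / κ, by rintro _ ⟨t, rfl⟩; exact Gbdd t⟩
    have g0 := hbv_barbalat G _ _ _ hG
      (fun t => ((hx t).const_sub 1).mul ((hx t).const_sub 1)) ?_ Gt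
    · have h1 : Tendsto (fun t => |1 - x t|) atTop (nhds 0) := by
        have := g0.sqrt
        simpa [Real.sqrt_mul_self_eq_abs] using this
      have h2 := (tendsto_zero_iff_abs_tendsto_zero _).2 h1
      simpa using h2.const_sub 1
    · have b1 := (HBdd.const 1).sub bx
      have b2 := (HBdd.const 0).sub bx'
      simpa using (b2.mul b1).add (b1.mul b2)
  -- `v → 1`
  have tv : Tendsto v atTop (nhds 1) := by
    have g0 := hbv_barbalat x _ _ _ hx
      (fun t => (((hx t).const_sub 1).const_mul m).add
        ((((hv t).mul (hx t)).const_sub 1).const_mul p)) (by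
        have := ((HBdd.const m).mul ((HBdd.const 0).sub bx')).add ((HBdd.const p).mul
          ((HBdd.const 0).sub ((bv'.mul bx).add (bv.mul bx'))))
        simpa using this) tx
    have h1 : Tendsto (fun t => (1 - (m * (1 - x t) + p * (1 - v t * x t) - m * (1 - x t)) / p) / x t)
        atTop (nhds ((1 - (0 - m * (1 - 1)) / p) / 1)) :=
      (((g0.sub ((tx.const_sub 1).const_mul m)).div_const p).const_sub 1).div tx one_ne_zero
    simp only [sub_self, mul_zero, zero_div, sub_zero, div_one] at h1
    refine h1.congr' ?_
    filter_upwards [eventually_ge_atTop 0] with t ht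
    have := (pos t ht).1
    field_simp
    ring
  have td : Tendsto d atTop (nhds 1) := by
    have g0 := hbv_barbalat v _ _ _ hv (fun t => ((hd t).sub (hv t)).const_mul s)
      ((HBdd.const s).mul (bd'.sub bv')) tv
    have h1 := (g0.div_const s).add tv
    simp only [zero_div, zero_add] at h1
    refine h1.congr fun t => ?_
    field_simp
    ring
  have ty : Tendsto y atTop (nhds 1) := by
    have g0 := hbv_barbalat d _ _ _ hd (fun t => ((hy t).sub (hd t)).const_mul r)
      ((HBdd.const r).mul (by'.sub bd')) td
    have h1 := (g0.div_const r).add td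
    simp only [zero_div, zero_add] at h1
    refine h1.congr fun t => ?_
    field_simp
    ring
  exact ⟨tx, ty, td, tv⟩

/-- Global asymptotic stability of the endemic equilibrium: if
R_s = αβ − (1−α)γ + δ > 0 and R₀ = akλαβ/(cδμR_s) > 1, then every solution of
the HBV system with X(0), Y(0), D(0), V(0) > 0 converges to the endemic
equilibrium E_i = (X₁, Y₁, D₁, V₁) as t → ∞. -/
theorem hbv_endemic_globally_stable
    (lam μ k δ a β γ c α Rs R₀ X₁ Y₁ D₁ V₁ : ℝ)
    (hlam : 0 < lam) (hμ : 0 < μ) (hk : 0 < k) (hδ : 0 < δ)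
    (ha : 0 < a) (hβ : 0 < β) (hγ : 0 < γ) (hc : 0 < c)
    (hα : α ∈ Set.Ioo (0 : ℝ) 1)
    (hRs : Rs = α * β - (1 - α) * γ + δ)
    (hRspos : 0 < Rs)
    (hR0 : R₀ = a * k * lam * α * β / (c * δ * μ * Rs))
    (hR0gt : 1 < R₀)
    (hX1 : X₁ = c * δ * Rs / (a * α * β * k))
    (hY1 : Y₁ = (a * α * β * k * lam - c * δ * μ * Rs) / (a * α * β * δ * k))
    (hD1 : D₁ = (a * α * β * k * lam - c * δ * μ * Rs) / (α * β * δ * k * Rs))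
    (hV1 : V₁ = (a * α * β * k * lam - c * δ * μ * Rs) / (c * δ * k * Rs))
    (X Y D V : ℝ → ℝ)
    (hX : ∀ t, HasDerivAt X (lam - μ * X t - k * V t * X t) t)
    (hY : ∀ t, HasDerivAt Y (k * V t * X t - δ * Y t) t)
    (hD : ∀ t, HasDerivAt D (a * Y t + γ * (1 - α) * D t - α * β * D t - δ * D t) t)
    (hV : ∀ t, HasDerivAt V (α * β * D t - c * V t) t)
    (hX0 : 0 < X 0) (hY0 : 0 < Y 0) (hD0 : 0 < D 0) (hV0 : 0 < V 0) :
    Tendsto (fun t => (X t, Y t, D t, V t)) atTop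
      (nhds (X₁, Y₁, D₁, V₁)) := by
  obtain ⟨hα0, hα1⟩ := hα
  have hN : 0 < a * α * β * k * lam - c * δ * μ * Rs := by
    rw [hR0, lt_div_iff₀ (by positivity)] at hR0gt
    linarith
  have pX : 0 < X₁ := by rw [hX1]; positivity
  have pY : 0 < Y₁ := by rw [hY1]; positivity
  have pD : 0 < D₁ := by rw [hD1]; positivity
  have pV : 0 < V₁ := by rw [hV1]; positivity
  have e1 : lam = μ * X₁ + k * V₁ * X₁ := by rw [hX1, hV1]; field_simp; ring
  have e2 : k * V₁ * X₁ = δ * Y₁ := by rw [hX1, hV1, hY1]; field_simp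
  have e3 : a * Y₁ = Rs * D₁ := by rw [hY1, hD1]; field_simp
  have e4 : α * β * D₁ = c * V₁ := by rw [hD1, hV1]; field_simp
  obtain ⟨tx, ty, td, tv⟩ := hbv_core μ (k * V₁) δ Rs c hμ (by positivity) hδ hRspos hc
    (fun t => X t / X₁) (fun t => Y t / Y₁) (fun t => D t / D₁) (fun t => V t / V₁)
    (fun t => by
      refine ((hX t).div_const X₁).congr_deriv ?_
      rw [e1]; field_simp; ring)
    (fun t => by
      refine ((hY t).div_const Y₁).congr_deriv ?_
      have : k * V t * X t = δ * Y₁ * (V t / V₁ * (X t / X₁)) := by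
        rw [← e2]; field_simp
      rw [this]; field_simp)
    (fun t => by
      refine ((hD t).div_const D₁).congr_deriv ?_
      have h1 : a * Y t = Rs * D₁ * (Y t / Y₁) := by
        rw [← e3]; field_simp
      have h2 : a * Y t + γ * (1 - α) * D t - α * β * D t - δ * D t
          = Rs * D₁ * (Y t / Y₁) - Rs * D t := by rw [← h1, hRs]; ring
      rw [h2]; field_simp)
    (fun t => by
      refine ((hV t).div_const V₁).congr_deriv ?_
      have h1 : α * β * D t = c * V₁ * (D t / D₁) := by
        rw [← e4]; field_simp
      rw [h1]; field_simp)
    (by positivity) (by positivity) (by positivity) (by positivity)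
  have fin : ∀ (f : ℝ → ℝ) (e : ℝ), 0 < e → Tendsto (fun t => f t / e) atTop (nhds 1) →
      Tendsto f atTop (nhds e) := by
    intro f e he h
    have := h.mul_const e
    rw [one_mul] at this
    exact this.congr fun t => by field_simp
  exact (fin X _ pX tx).prodMk_nhds ((fin Y _ pY ty).prodMk_nhds
    ((fin D _ pD td).prodMk_nhds (fin V _ pV tv)))
end
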